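/- Source condition estimate: Let K_α be the diagonal operator K_α f = Σ_n E_α(−n²τ^α)⟨f,φ_n⟩φ_n on L²[0,π], and suppose f₀ = K_α u with ‖u‖ ≤ ρ. Assume |E_α(−x) − 1| ≤ C x/(1+x) and E_α(−x) ≤ C₂/(Γ(1−α)(1+x)) for x > 0. Then for 0 < t ≤ τ, ‖u_α(·,t) − f₀‖ ≤ ρ C_α t^α/τ^α, where C_α = C C₂/Γ(1−α) and u_α(·,t) = Σ_n E_α(−n²t^α)⟨f₀,φ_n⟩φ_n. -/

import Mathlib

open scoped RealInnerProductSpace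

/-- The (real-valued) Mittag-Leffler function `E_α(x) = ∑ x^k / Γ(αk+1)`. -/
noncomputable def mittagLeffler (α x : ℝ) : ℝ :=
  ∑' k : ℕ, x ^ k / Real.Gamma (α * k + 1)

open Filter Topology Finset.HasAntidiagonal

section Multichoose

theorem succ_mul_multichoose_succ (r : ℝ) (n : ℕ) :
    ((n : ℝ) + 1) * Ring.multichoose r (n + 1) = (r + n) * Ring.multichoose r n := by
  have h1 := Ring.factorial_nsmul_multichoose_eq_ascPochhammer r (n + 1)
  have h0 := Ring.factorial_nsmul_multichoose_eq_ascPochhammer r n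
  rw [Polynomial.ascPochhammer_smeval_eq_eval, nsmul_eq_mul] at h0 h1
  rw [ascPochhammer_succ_eval, ← h0, Nat.factorial_succ] at h1
  have hn : (n.factorial : ℝ) ≠ 0 := by positivity
  push_cast at h1
  apply mul_left_cancel₀ hn
  linear_combination h1

theorem multichoose_add (r s : ℝ) (n : ℕ) :
    Ring.multichoose (r + s) n =
      ∑ p ∈ antidiagonal n, Ring.multichoose r p.1 * Ring.multichoose s p.2 := by
  have key : ∀ (a : ℝ) (k : ℕ), Ring.multichoose a k = (-1) ^ k * Ring.choose (-a) k := by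
    intro a k
    rw [Ring.choose_neg', Units.smul_def, Int.coe_negOnePow_natCast, zsmul_eq_mul, ← mul_assoc]
    push_cast
    rw [← mul_pow]
    simp
  rw [key, neg_add, Ring.add_choose_eq n (Commute.all _ _), Finset.mul_sum]
  refine Finset.sum_congr rfl fun p hp => ?_
  rw [key r, key s, ← mem_antidiagonal.1 hp, pow_add]
  ring

theorem multichoose_nonneg {r : ℝ} (hr : 0 ≤ r) (n : ℕ) : 0 ≤ Ring.multichoose r n := by
  induction n with
  | zero => simp
  | succ n ih =>
    have h := succ_mul_multichoose_succ r n
    have : 0 ≤ (r + n) * Ring.multichoose r n := by positivity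
    rw [← h] at this
    exact nonneg_of_mul_nonneg_right this (by positivity)

theorem multichoose_pos {r : ℝ} (hr : 0 < r) (n : ℕ) : 0 < Ring.multichoose r n := by
  induction n with
  | zero => simp
  | succ n ih =>
    have h := succ_mul_multichoose_succ r n
    have : 0 < (r + n) * Ring.multichoose r n := by positivity
    rw [← h] at this
    exact pos_of_mul_pos_right this (by positivity)

theorem multichoose_neg_succ_nonpos {α : ℝ} (hα : 0 ≤ α) (hα1 : α ≤ 1) (n : ℕ) :
    Ring.multichoose (-α) (n + 1) ≤ 0 := by
  induction n with
  | zero => simpa using hα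
  | succ n ih =>
    have h := succ_mul_multichoose_succ (-α) (n + 1)
    have h2 : (-α + ((n + 1 : ℕ) : ℝ)) * Ring.multichoose (-α) (n + 1) ≤ 0 := by
      refine mul_nonpos_of_nonneg_of_nonpos ?_ ih
      push_cast
      linarith [(Nat.cast_nonneg n : (0 : ℝ) ≤ n)]
    rw [← h] at h2
    exact nonpos_of_mul_nonpos_right h2 (by positivity)

theorem multichoose_add_one_succ (a : ℝ) (n : ℕ) :
    Ring.multichoose (a + 1) (n + 1) = (1 + a / (n + 1)) * Ring.multichoose (a + 1) n := by
  have h := succ_mul_multichoose_succ (a + 1) n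
  have hn : (n : ℝ) + 1 ≠ 0 := by positivity
  field_simp
  linear_combination h

theorem multichoose_add_one_le_pow {a : ℝ} (ha : 0 ≤ a) (n : ℕ) :
    Ring.multichoose (a + 1) n ≤ (1 + a) ^ n := by
  induction n with
  | zero => simp
  | succ n ih =>
    rw [multichoose_add_one_succ, pow_succ']
    have : a / (n + 1) ≤ a := div_le_self ha (by linarith [(Nat.cast_nonneg n : (0 : ℝ) ≤ n)])
    have h0 := multichoose_nonneg (by linarith : 0 ≤ a + 1) n
    gcongr

theorem multichoose_add_one_le_rpow {a : ℝ} (ha : 0 ≤ a) {K n : ℕ} (hK : 0 < K) (hn : K ≤ n) :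
    Ring.multichoose (a + 1) n ≤ (1 + a) ^ K * ((n : ℝ) / K) ^ a := by
  have hK' : (0 : ℝ) < K := by exact_mod_cast hK
  induction n, hn using Nat.le_induction with
  | base =>
    rw [div_self hK'.ne', Real.one_rpow, mul_one]
    exact multichoose_add_one_le_pow ha K
  | succ n hn ih =>
    have hn' : (0 : ℝ) < n := by exact_mod_cast hK.trans_le hn
    have hstep : 1 + a / (n + 1) ≤ (((n : ℝ) + 1) / n) ^ a := by
      have hpos : 0 < ((n : ℝ) + 1) / n := by positivity
      have h1 := Real.one_sub_inv_le_log_of_pos hpos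
      have h2 : 1 - (((n : ℝ) + 1) / n)⁻¹ = 1 / (n + 1) := by field_simp; ring
      rw [h2] at h1
      rw [Real.rpow_def_of_pos hpos]
      have h3 := Real.add_one_le_exp (Real.log (((n : ℝ) + 1) / n) * a)
      have h4 := mul_le_mul_of_nonneg_right h1 ha
      have h5 : 1 / ((n : ℝ) + 1) * a = a / (n + 1) := by ring
      linarith
    have h0 := multichoose_nonneg (by linarith : 0 ≤ a + 1) n
    calc Ring.multichoose (a + 1) (n + 1)
        = (1 + a / (n + 1)) * Ring.multichoose (a + 1) n := multichoose_add_one_succ a n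
      _ ≤ (((n : ℝ) + 1) / n) ^ a * ((1 + a) ^ K * ((n : ℝ) / K) ^ a) := by gcongr
      _ = (1 + a) ^ K * ((((n : ℝ) + 1) / n) * (n / K)) ^ a := by
        rw [Real.mul_rpow (by positivity) (by positivity)]; ring
      _ = (1 + a) ^ K * (((n + 1 : ℕ) : ℝ) / K) ^ a := by
        congr 2
        push_cast
        field_simp

theorem tendsto_multichoose_div_rpow {a : ℝ} (ha : 0 ≤ a) :
    Tendsto (fun n : ℕ => Ring.multichoose (a + 1) n / (n : ℝ) ^ a) atTop
      (𝓝 (1 / Real.Gamma (a + 1))) := by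
  have hG := Real.GammaSeq_tendsto_Gamma (a + 1)
  have hG0 : Real.Gamma (a + 1) ≠ 0 := (Real.Gamma_pos_of_pos (by linarith)).ne'
  have h1 := (tendsto_natCast_div_add_atTop (𝕜 := ℝ) (a + 1)).div hG hG0
  refine h1.congr' ?_
  filter_upwards [eventually_gt_atTop 0] with n hn
  have hn' : (0 : ℝ) < n := by exact_mod_cast hn
  have hprod : ∀ m : ℕ, ∏ j ∈ Finset.range m, (a + 1 + (j : ℝ)) =
      m.factorial * Ring.multichoose (a + 1) m := by
    intro m
    induction m with
    | zero => simp
    | succ m ih =>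
      have h := succ_mul_multichoose_succ (a + 1) m
      rw [Finset.prod_range_succ, ih, Nat.factorial_succ]
      push_cast
      linear_combination -(m.factorial : ℝ) * h
  have hm := multichoose_pos (by linarith : 0 < a + 1) n
  have hf : (0 : ℝ) < n.factorial := by positivity
  simp only [Pi.div_apply, Real.GammaSeq]
  rw [Finset.prod_range_succ, hprod, Real.rpow_add hn', Real.rpow_one]
  have hna : (0 : ℝ) < (n : ℝ) ^ a := by positivity
  field_simp
  ring

end Multichoose

theorem summable_succ_pow_mul_geometric (K : ℕ) {r : ℝ} (hr : 0 < r) (hr1 : r < 1) :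
    Summable fun k : ℕ => (1 + (k : ℝ)) ^ K * r ^ k := by
  have h := summable_pow_mul_geometric_of_norm_lt_one (R := ℝ) K (r := r)
    (by rwa [Real.norm_of_nonneg hr.le])
  have h2 := ((summable_nat_add_iff 1).2 h).mul_right r⁻¹
  refine h2.congr fun k => ?_
  push_cast
  field_simp
  ring

/-- The backward Euler convolution quadrature approximation of the Mittag-Leffler function:
the `n`-th coefficient of `(1 - z)^(α - 1) / ((1 - z)^α + h)`. -/
noncomputable def eulerMittagLeffler (α h : ℝ) (n : ℕ) : ℝ :=
  ∑' k : ℕ, (-h) ^ k * Ring.multichoose (α * k + 1) n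

theorem summable_eulerMittagLeffler {α h : ℝ} (hα : 0 ≤ α) (hα1 : α ≤ 1) (hh : 0 < h)
    (hh1 : h < 1) (n : ℕ) :
    Summable fun k : ℕ => (-h) ^ k * Ring.multichoose (α * k + 1) n := by
  refine Summable.of_norm_bounded (summable_succ_pow_mul_geometric n hh hh1) fun k => ?_
  have hak : 0 ≤ α * k := by positivity
  have hm := multichoose_nonneg (by linarith : 0 ≤ α * k + 1) n
  have hle : α * k ≤ k := mul_le_of_le_one_left (Nat.cast_nonneg k) hα1
  rw [norm_mul, norm_pow, norm_neg, Real.norm_of_nonneg hh.le, Real.norm_of_nonneg hm, mul_comm]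
  gcongr
  exact (multichoose_add_one_le_pow hak n).trans (by gcongr)

theorem eulerMittagLeffler_recursion {α h : ℝ} (hα : 0 ≤ α) (hα1 : α ≤ 1) (hh : 0 < h)
    (hh1 : h < 1) (n : ℕ) :
    ∑ p ∈ antidiagonal n, Ring.multichoose (-α) p.1 * eulerMittagLeffler α h p.2 =
      Ring.multichoose (1 - α) n - h * eulerMittagLeffler α h n := by
  have hs := summable_eulerMittagLeffler hα hα1 hh hh1
  have hterm : ∀ k : ℕ, ∑ p ∈ antidiagonal n,
      Ring.multichoose (-α) p.1 * ((-h) ^ k * Ring.multichoose (α * k + 1) p.2) =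
      (-h) ^ k * Ring.multichoose (-α + (α * k + 1)) n := by
    intro k
    rw [multichoose_add, Finset.mul_sum]
    exact Finset.sum_congr rfl fun p _ => by ring
  have hsum : Summable fun k : ℕ => (-h) ^ k * Ring.multichoose (-α + (α * k + 1)) n := by
    simp_rw [← hterm]
    exact summable_sum fun p _ => (hs p.2).mul_left _
  calc ∑ p ∈ antidiagonal n, Ring.multichoose (-α) p.1 * eulerMittagLeffler α h p.2
      = ∑' k : ℕ, (-h) ^ k * Ring.multichoose (-α + (α * k + 1)) n := by
        simp_rw [← hterm, eulerMittagLeffler, ← tsum_mul_left]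
        exact (Summable.tsum_finsetSum fun p _ => (hs p.2).mul_left _).symm
    _ = Ring.multichoose (1 - α) n - h * eulerMittagLeffler α h n := by
        rw [hsum.tsum_eq_zero_add, eulerMittagLeffler, ← tsum_mul_left, sub_eq_add_neg,
          ← tsum_neg]
        congr 1
        · simp only [pow_zero, one_mul, Nat.cast_zero, mul_zero, zero_add]
          congr 1
          ring
        · refine tsum_congr fun k => ?_
          have : -α + (α * ((k + 1 : ℕ) : ℝ) + 1) = α * k + 1 := by push_cast; ring
          rw [this]
          ring

theorem eulerMittagLeffler_nonneg {α h : ℝ} (hα : 0 ≤ α) (hα1 : α ≤ 1) (hh : 0 < h)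
    (hh1 : h < 1) (n : ℕ) : 0 ≤ eulerMittagLeffler α h n := by
  induction n using Nat.strong_induction_on with
  | _ n ih =>
    have hrec := eulerMittagLeffler_recursion hα hα1 hh hh1 n
    have hm := multichoose_nonneg (by linarith : 0 ≤ 1 - α) n
    have hmain : 0 ≤ (1 + h) * eulerMittagLeffler α h n := by
      cases n with
      | zero =>
        simp only [antidiagonal_zero, Finset.sum_singleton, Ring.multichoose_zero_right,
          one_mul] at hrec hm
        linarith
      | succ n =>
        rw [Finset.Nat.sum_antidiagonal_succ] at hrec
        simp only [Ring.multichoose_zero_right, one_mul] at hrec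
        have : ∑ p ∈ antidiagonal n,
            Ring.multichoose (-α) (p.1 + 1) * eulerMittagLeffler α h p.2 ≤ 0 := by
          refine Finset.sum_nonpos fun p hp => ?_
          exact mul_nonpos_of_nonpos_of_nonneg (multichoose_neg_succ_nonpos hα hα1 _)
            (ih _ (Nat.lt_succ_of_le (antidiagonal.snd_le hp)))
        linarith
    exact nonneg_of_mul_nonneg_right hmain (by linarith)

theorem tendsto_eulerMittagLeffler {α x : ℝ} (hα : 0 < α) (hα1 : α ≤ 1) (hx : 0 < x) :
    Tendsto (fun n : ℕ => eulerMittagLeffler α (x / (n : ℝ) ^ α) n) atTop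
      (𝓝 (mittagLeffler α (-x))) := by
  have hpow : Tendsto (fun n : ℕ => x / (n : ℝ) ^ α) atTop (𝓝 0) :=
    tendsto_const_nhds.div_atTop
      ((tendsto_rpow_atTop hα).comp tendsto_natCast_atTop_atTop)
  obtain ⟨K, hK1, hK⟩ :=
    ((hpow.eventually_lt_const one_pos).and (eventually_gt_atTop 0)).exists
  have hK' : (0 : ℝ) < K := by exact_mod_cast hK
  have hr : 0 < x / (K : ℝ) ^ α := by positivity
  have hterm : ∀ n : ℕ, ∀ k : ℕ, (-(x / (n : ℝ) ^ α)) ^ k * Ring.multichoose (α * k + 1) n =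
      (-x) ^ k * (Ring.multichoose (α * k + 1) n / (n : ℝ) ^ (α * k)) := by
    intro n k
    rw [Real.rpow_mul_natCast (Nat.cast_nonneg n), ← neg_div, div_pow]
    ring
  unfold eulerMittagLeffler mittagLeffler
  refine tendsto_tsum_of_dominated_convergence
    (summable_succ_pow_mul_geometric K hr hK1) (fun k => ?_) ?_
  · simp_rw [hterm]
    rw [div_eq_mul_one_div ((-x) ^ k)]
    exact (tendsto_multichoose_div_rpow (by positivity)).const_mul _
  · filter_upwards [eventually_ge_atTop K] with n hn k
    have hn' : (0 : ℝ) < n := by exact_mod_cast hK.trans_le hn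
    have hak : 0 ≤ α * k := by positivity
    have hm := multichoose_nonneg (by linarith : 0 ≤ α * k + 1) n
    have hle : α * k ≤ k := mul_le_of_le_one_left (Nat.cast_nonneg k) hα1
    rw [hterm, norm_mul, norm_pow, norm_neg, Real.norm_of_nonneg hx.le,
      Real.norm_of_nonneg (by positivity)]
    have hb := multichoose_add_one_le_rpow hak hK hn
    calc x ^ k * (Ring.multichoose (α * k + 1) n / (n : ℝ) ^ (α * k))
        ≤ x ^ k * (((1 + α * k) ^ K * ((n : ℝ) / K) ^ (α * k)) / (n : ℝ) ^ (α * k)) := by gcongr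
      _ = (1 + α * k) ^ K * (x / (K : ℝ) ^ α) ^ k := by
        rw [Real.div_rpow hn'.le hK'.le, div_pow, Real.rpow_mul_natCast hK'.le]
        have : (0 : ℝ) < (n : ℝ) ^ (α * k) := by positivity
        field_simp
      _ ≤ (1 + (k : ℝ)) ^ K * (x / (K : ℝ) ^ α) ^ k := by gcongr

theorem mittagLeffler_neg_nonneg {α x : ℝ} (hα : 0 < α) (hα1 : α ≤ 1) (hx : 0 < x) :
    0 ≤ mittagLeffler α (-x) := by
  refine ge_of_tendsto (tendsto_eulerMittagLeffler hα hα1 hx) ?_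
  have hpow : Tendsto (fun n : ℕ => x / (n : ℝ) ^ α) atTop (𝓝 0) :=
    tendsto_const_nhds.div_atTop
      ((tendsto_rpow_atTop hα).comp tendsto_natCast_atTop_atTop)
  filter_upwards [hpow.eventually_lt_const one_pos, eventually_gt_atTop 0] with n hn hn0
  have hn' : (0 : ℝ) < n := by exact_mod_cast hn0
  exact eulerMittagLeffler_nonneg hα.le hα1 (by positivity) hn n

section HilbertBasis

variable {ι H : Type*} [NormedAddCommGroup H] [InnerProductSpace ℝ H]

theorem HilbertBasis.hasSum_inner_sq (φ : HilbertBasis ι ℝ H) (w : H) :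
    HasSum (fun i => ⟪w, φ i⟫ ^ 2) (‖w‖ ^ 2) := by
  have h := φ.hasSum_inner_mul_inner w w
  rw [real_inner_self_eq_norm_sq] at h
  refine h.congr_fun fun i => ?_
  rw [real_inner_comm w, sq]

theorem HilbertBasis.norm_le_mul_norm_of_abs_inner_le (φ : HilbertBasis ι ℝ H) {u w : H} {M : ℝ}
    (hM : 0 ≤ M) (h : ∀ i, |⟪w, φ i⟫| ≤ M * |⟪u, φ i⟫|) : ‖w‖ ≤ M * ‖u‖ := by
  refine le_of_sq_le_sq ?_ (by positivity)
  rw [mul_pow]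
  refine hasSum_le (fun i => ?_) (φ.hasSum_inner_sq w) ((φ.hasSum_inner_sq u).mul_left (M ^ 2))
  rw [← sq_abs, ← sq_abs ⟪u, φ i⟫, ← mul_pow]
  exact pow_le_pow_left₀ (abs_nonneg _) (h i) 2

theorem HilbertBasis.inner_tsum_mul_inner_smul (φ : HilbertBasis ι ℝ H) {m : ι → ℝ} {M : ℝ}
    (hm : ∀ i, |m i| ≤ M) (u : H) (i : ι) :
    ⟪∑' j, (m j * ⟪u, φ j⟫) • φ j, φ i⟫ = m i * ⟪u, φ i⟫ := by
  have hmem : Memℓp (fun j => m j * ⟪u, φ j⟫) 2 := by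
    refine memℓp_gen ?_
    refine Summable.of_nonneg_of_le (fun j => by positivity) (fun j => ?_)
      ((φ.hasSum_inner_sq u).summable.mul_left (M ^ 2))
    simp only [ENNReal.toReal_ofNat, Real.rpow_ofNat, Real.norm_eq_abs, sq_abs, mul_pow]
    exact mul_le_mul_of_nonneg_right (sq_le_sq' (abs_le.1 (hm j)).1 (abs_le.1 (hm j)).2)
      (sq_nonneg _)
  have hsum := φ.hasSum_repr_symm ⟨_, hmem⟩
  rw [hsum.tsum_eq, real_inner_comm, ← φ.repr_apply_apply, LinearIsometryEquiv.apply_symm_apply]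

end HilbertBasis

/-- source condition estimate, Theorem 6.2: if `f₀ = K_α u` with `‖u‖ ≤ ρ`,
where `K_α f = ∑_n E_α(−λ_n²τ^α)⟨f,φ_n⟩φ_n` (`λ_n = n+1`), and
`|E_α(−x) − 1| ≤ Cx/(1+x)`, `E_α(−x) ≤ C₂/(Γ(1−α)(1+x))` for `x > 0`, then for `0 < t ≤ τ`,
`‖u_α(·,t) − f₀‖ ≤ ρ C_α t^α/τ^α` with `C_α = C C₂/Γ(1−α)`. -/
theorem source_condition_estimate
    {H : Type*} [NormedAddCommGroup H] [InnerProductSpace ℝ H] [CompleteSpace H]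
    (φ : HilbertBasis ℕ ℝ H)
    (α τ t C C₂ ρ : ℝ) (hα : 0 < α) (hα1 : α < 1) (hτ : 0 < τ)
    (ht : 0 < t) (htτ : t ≤ τ) (hC : 0 < C) (hC₂ : 0 < C₂) (hρ : 0 ≤ ρ)
    (hE1 : ∀ x : ℝ, 0 < x → |mittagLeffler α (-x) - 1| ≤ C * x / (1 + x))
    (hE2 : ∀ x : ℝ, 0 < x → mittagLeffler α (-x) ≤ C₂ / (Real.Gamma (1 - α) * (1 + x)))
    (u f₀ ut : H) (hu : ‖u‖ ≤ ρ)
    (hf₀ : f₀ = ∑' n : ℕ, (mittagLeffler α (-((n + 1 : ℝ) ^ 2 * τ ^ α)) * ⟪u, φ n⟫) • φ n)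
    (hut : ut = ∑' n : ℕ, (mittagLeffler α (-((n + 1 : ℝ) ^ 2 * t ^ α)) * ⟪f₀, φ n⟫) • φ n) :
    ‖ut - f₀‖ ≤ ρ * (C * C₂ / Real.Gamma (1 - α)) * (t ^ α / τ ^ α) := by
  have hΓ : 0 < Real.Gamma (1 - α) := Real.Gamma_pos_of_pos (by linarith)
  set A := C₂ / Real.Gamma (1 - α) with hA
  have hA0 : 0 < A := by positivity
  have hE0 : ∀ x : ℝ, 0 < x → 0 ≤ mittagLeffler α (-x) := fun x hx =>
    mittagLeffler_neg_nonneg hα hα1.le hx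
  have hE2' : ∀ x : ℝ, 0 < x → |mittagLeffler α (-x)| ≤ A / (1 + x) := fun x hx => by
    rw [abs_of_nonneg (hE0 x hx), hA, div_div]
    exact hE2 x hx
  have hEb : ∀ x : ℝ, 0 < x → |mittagLeffler α (-x)| ≤ A := fun x hx =>
    (hE2' x hx).trans (div_le_self hA0.le (by linarith))
  have hx : ∀ n : ℕ, 0 < (n + 1 : ℝ) ^ 2 * t ^ α := fun n => by positivity
  have hy : ∀ n : ℕ, 0 < (n + 1 : ℝ) ^ 2 * τ ^ α := fun n => by positivity
  have hif : ∀ n, ⟪f₀, φ n⟫ = mittagLeffler α (-((n + 1 : ℝ) ^ 2 * τ ^ α)) * ⟪u, φ n⟫ := by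
    intro n
    rw [hf₀]
    exact φ.inner_tsum_mul_inner_smul (fun j => hEb _ (hy j)) u n
  have hit : ∀ n, ⟪ut, φ n⟫ = mittagLeffler α (-((n + 1 : ℝ) ^ 2 * t ^ α)) * ⟪f₀, φ n⟫ := by
    intro n
    rw [hut]
    exact φ.inner_tsum_mul_inner_smul (fun j => hEb _ (hx j)) f₀ n
  have hM : 0 ≤ C * A * (t ^ α / τ ^ α) := by positivity
  have hbound : ‖ut - f₀‖ ≤ C * A * (t ^ α / τ ^ α) * ‖u‖ := by
    refine φ.norm_le_mul_norm_of_abs_inner_le hM fun n => ?_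
    have hfac : ⟪ut - f₀, φ n⟫ = (mittagLeffler α (-((n + 1 : ℝ) ^ 2 * t ^ α)) - 1) *
        mittagLeffler α (-((n + 1 : ℝ) ^ 2 * τ ^ α)) * ⟪u, φ n⟫ := by
      rw [inner_sub_left, hit, hif]
      ring
    rw [hfac, abs_mul, abs_mul]
    refine mul_le_mul_of_nonneg_right ?_ (abs_nonneg _)
    have hx' := hx n
    have hy' := hy n
    have hratio : t ^ α / τ ^ α = ((n + 1 : ℝ) ^ 2 * t ^ α) / ((n + 1 : ℝ) ^ 2 * τ ^ α) := by
      rw [mul_div_mul_left _ _ (by positivity)]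
    rw [hratio]
    generalize (n + 1 : ℝ) ^ 2 * t ^ α = x at hx' ⊢
    generalize (n + 1 : ℝ) ^ 2 * τ ^ α = y at hy' ⊢
    have h1 : |mittagLeffler α (-x) - 1| ≤ C * x :=
      (hE1 x hx').trans (div_le_self (by positivity) (by linarith))
    have h2 : |mittagLeffler α (-y)| ≤ A / y :=
      (hE2' y hy').trans (by gcongr; linarith)
    calc |mittagLeffler α (-x) - 1| * |mittagLeffler α (-y)|
        ≤ (C * x) * (A / y) := by gcongr
      _ = C * A * (x / y) := by ring
  calc ‖ut - f₀‖ ≤ C * A * (t ^ α / τ ^ α) * ‖u‖ := hbound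
    _ ≤ C * A * (t ^ α / τ ^ α) * ρ := by gcongr
    _ = ρ * (C * C₂ / Real.Gamma (1 - α)) * (t ^ α / τ ^ α) := by rw [hA]; ring
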